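/- For any θ ∈ (−1,1) and any positive real numbers x ≠ y, the divided difference satisfies (x^θ − y^θ)/(θ(x−y)) = sinc(θπ) · ∫_0^∞ t^θ/((x+t)(y+t)) dt = ∫_{−∞}^{∞} x^{−(1−θ+it)/2} y^{−(1−θ−it)/2} β_θ(t) dt, where for θ = 0 the left-hand side is interpreted as the limit (log x − log y)/(x−y). Moreover, for each θ ∈ (−1,1) the function t ↦ β_θ(t) is a probability density on ℝ, i.e. it is nonnegative and ∫_{−∞}^{∞} β_θ(t) dt = 1. -/

import Mathlib

open scoped BigOperators ComplexOrder Classical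
open MeasureTheory Filter Set

noncomputable section

namespace QHT

variable {ι : Type*} [Fintype ι] [DecidableEq ι]

/-- Generalized matrix power `A ^ w` (complex exponent `w`) of a Hermitian matrix,
via functional calculus on the support: the eigenvalue `0` is mapped to `0`. -/
def mpow (A : Matrix ι ι ℂ) (w : ℂ) : Matrix ι ι ℂ :=
  if hA : A.IsHermitian then
    (hA.eigenvectorUnitary : Matrix ι ι ℂ) *
      Matrix.diagonal (fun i => if hA.eigenvalues i = 0 then 0 else (hA.eigenvalues i : ℂ) ^ w) *
      star (hA.eigenvectorUnitary : Matrix ι ι ℂ)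
  else 0

/-- Matrix logarithm of a Hermitian matrix, taken on its support
(`Real.log 0 = 0`, so the kernel is mapped to `0`). -/
def mlog (A : Matrix ι ι ℂ) : Matrix ι ι ℂ :=
  if hA : A.IsHermitian then
    (hA.eigenvectorUnitary : Matrix ι ι ℂ) *
      Matrix.diagonal (fun i => (Real.log (hA.eigenvalues i) : ℂ)) *
      star (hA.eigenvectorUnitary : Matrix ι ι ℂ)
  else 0

/-- The support of a matrix, i.e. its range as a linear map. -/
def msupp (A : Matrix ι ι ℂ) : Submodule ℂ (ι → ℂ) := LinearMap.range A.mulVecLin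

/-- A quantum state: a positive semidefinite matrix of trace one. -/
def IsState (A : Matrix ι ι ℂ) : Prop := A.PosSemidef ∧ A.trace = 1

/-- Real part of the trace. -/
def rtr (A : Matrix ι ι ℂ) : ℝ := A.trace.re

/-- The Umegaki relative entropy `D(ρ‖σ)`, with value `+∞` when `supp ρ ⊄ supp σ`. -/
def relEnt (ρ σ : Matrix ι ι ℂ) : EReal :=
  if msupp ρ ≤ msupp σ then ((rtr (ρ * (mlog ρ - mlog σ)) : ℝ) : EReal) else ⊤

/-- The polar of a set of matrices (intersected with the PSD cone). -/
def polar (S : Set (Matrix ι ι ℂ)) : Set (Matrix ι ι ℂ) :=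
  {X | X.PosSemidef ∧ ∀ Y ∈ S, rtr (X * Y) ≤ 1}

/-- Entrywise Bochner integral of a matrix-valued function over `ℝ`. -/
def mInt (f : ℝ → Matrix ι ι ℂ) : Matrix ι ι ℂ :=
  Matrix.of fun i j => ∫ t : ℝ, f t i j

/-- Entrywise Bochner integral of a matrix-valued function over a set `s ⊆ ℝ`. -/
def mIntOn (f : ℝ → Matrix ι ι ℂ) (s : Set ℝ) : Matrix ι ι ℂ :=
  Matrix.of fun i j => ∫ t in s, f t i j

/-- `sinc` function. -/
def sinc (s : ℝ) : ℝ := if s = 0 then 1 else Real.sin s / s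

/-- The probability density `β_θ` from the paper (`β₀` is the `θ → 0` limit). -/
def betaDist (θ t : ℝ) : ℝ :=
  if θ = 0 then Real.pi / (2 * (Real.cosh (Real.pi * t) + 1))
  else Real.sin (θ * Real.pi) / (2 * θ * (Real.cosh (Real.pi * t) + Real.cos (θ * Real.pi)))

/-- `Q_{α,z}(ρ‖σ) = Tr[(ρ^{α/2z} σ^{(1-α)/z} ρ^{α/2z})^z]`. -/
def Qaz (α z : ℝ) (ρ σ : Matrix ι ι ℂ) : ℝ :=
  rtr (mpow (mpow ρ ((α / (2 * z) : ℝ) : ℂ) * mpow σ (((1 - α) / z : ℝ) : ℂ) *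
      mpow ρ ((α / (2 * z) : ℝ) : ℂ)) ((z : ℝ) : ℂ))

/-- The `α`-`z` Rényi relative entropy. -/
def Daz (α z : ℝ) (ρ σ : Matrix ι ι ℂ) : EReal :=
  if (α < 1 ∧ (ρ * σ).trace ≠ 0) ∨ msupp ρ ≤ msupp σ then
    (((α - 1)⁻¹ * Real.log (Qaz α z ρ σ) : ℝ) : EReal)
  else ⊤

/-- `Q_α(ρ‖σ) = Tr[ρ^α σ^{1-α}]` (Petz). -/
def Qpetz (α : ℝ) (ρ σ : Matrix ι ι ℂ) : ℝ :=
  rtr (mpow ρ ((α : ℝ) : ℂ) * mpow σ (((1 - α) : ℝ) : ℂ))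

/-- The Petz Rényi divergence. -/
def Dpetz (α : ℝ) (ρ σ : Matrix ι ι ℂ) : EReal :=
  if (α < 1 ∧ (ρ * σ).trace ≠ 0) ∨ msupp ρ ≤ msupp σ then
    (((α - 1)⁻¹ * Real.log (Qpetz α ρ σ) : ℝ) : EReal)
  else ⊤

/-- `Q̃_α(ρ‖σ) = Tr[(σ^{(1-α)/2α} ρ σ^{(1-α)/2α})^α]` (sandwiched). -/
def Qsand (α : ℝ) (ρ σ : Matrix ι ι ℂ) : ℝ :=
  rtr (mpow (mpow σ (((1 - α) / (2 * α) : ℝ) : ℂ) * ρ * mpow σ (((1 - α) / (2 * α) : ℝ) : ℂ))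
    ((α : ℝ) : ℂ))

/-- The sandwiched Rényi divergence. -/
def Dsand (α : ℝ) (ρ σ : Matrix ι ι ℂ) : EReal :=
  if (α < 1 ∧ (ρ * σ).trace ≠ 0) ∨ msupp ρ ≤ msupp σ then
    (((α - 1)⁻¹ * Real.log (Qsand α ρ σ) : ℝ) : EReal)
  else ⊤

/-- `D̃_∞(ρ‖σ)`: the limit of `D̃_α(ρ‖σ)` as `α → +∞` (encoded as a `limsup`; the limit
exists by monotonicity in `α`). -/
def DsandInf (ρ σ : Matrix ι ι ℂ) : EReal :=
  Filter.limsup (fun α : ℝ => Dsand α ρ σ) Filter.atTop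

/-- `χ_{α,z}(ρ,σ) = ρ^{α/2z} (ρ^{α/2z} σ^{(1-α)/z} ρ^{α/2z})^{z-1} ρ^{α/2z}`. -/
def chi (α z : ℝ) (ρ σ : Matrix ι ι ℂ) : Matrix ι ι ℂ :=
  mpow ρ ((α / (2 * z) : ℝ) : ℂ) *
    mpow (mpow ρ ((α / (2 * z) : ℝ) : ℂ) * mpow σ (((1 - α) / z : ℝ) : ℂ) *
      mpow ρ ((α / (2 * z) : ℝ) : ℂ)) (((z - 1 : ℝ)) : ℂ) *
    mpow ρ ((α / (2 * z) : ℝ) : ℂ)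

/-- The data-processing region `𝒟` for `α`-`z` Rényi relative entropies. -/
def Dregion : Set (ℝ × ℝ) :=
  {p | (0 < p.1 ∧ p.1 < 1 ∧ max p.1 (1 - p.1) ≤ p.2) ∨
       (1 < p.1 ∧ max (p.1 / 2) (p.1 - 1) ≤ p.2 ∧ p.2 ≤ p.1) ∨
       (p.1 = 1 ∧ 0 < p.2)}

end QHT

namespace QHT

variable {ι : Type*} [Fintype ι] [DecidableEq ι]

/-! ### Tensor products and many copies -/

/-- Tensor product of a `d₁`- and a `d₂`-dimensional operator, as a `d₁d₂`-dimensional one. -/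
def dtens {a b : ℕ} (A : Matrix (Fin a) (Fin a) ℂ) (B : Matrix (Fin b) (Fin b) ℂ) :
    Matrix (Fin (a * b)) (Fin (a * b)) ℂ :=
  Matrix.of fun x y =>
    A (finProdFinEquiv.symm x).1 (finProdFinEquiv.symm y).1 *
      B (finProdFinEquiv.symm x).2 (finProdFinEquiv.symm y).2

/-- `ρ^{⊗n}` of a `d`-dimensional operator, as a `d^n`-dimensional operator. -/
def dpow {d : ℕ} (ρ : Matrix (Fin d) (Fin d) ℂ) (n : ℕ) :
    Matrix (Fin (d ^ n)) (Fin (d ^ n)) ℂ :=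
  Matrix.of fun x y => ∏ i, ρ (finFunctionFinEquiv.symm x i) (finFunctionFinEquiv.symm y i)

/-- The action of a permutation of the `k` tensor factors on an operator on `(ℂ^d)^{⊗k}`. -/
def permMat (d k : ℕ) (π : Equiv.Perm (Fin k)) (A : Matrix (Fin (d ^ k)) (Fin (d ^ k)) ℂ) :
    Matrix (Fin (d ^ k)) (Fin (d ^ k)) ℂ :=
  Matrix.of fun x y =>
    A (finFunctionFinEquiv ((finFunctionFinEquiv.symm x) ∘ π))
      (finFunctionFinEquiv ((finFunctionFinEquiv.symm y) ∘ π))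

/-- `ρ^{⊗n}` of a `d`-dimensional operator, as an operator on `H^{⊗n}` with `H = ℂ^d`,
indexed by tuples. -/
def tpow {d : ℕ} (ρ : Matrix (Fin d) (Fin d) ℂ) (n : ℕ) :
    Matrix (Fin n → Fin d) (Fin n → Fin d) ℂ :=
  Matrix.of fun x y => ∏ i, ρ (x i) (y i)

/-- Tensor product of an operator on `H^{⊗m}` and an operator on `H^{⊗n}`, as an
operator on `H^{⊗(m+n)}`. -/
def tensOp {d m n : ℕ} (A : Matrix (Fin m → Fin d) (Fin m → Fin d) ℂ)
    (B : Matrix (Fin n → Fin d) (Fin n → Fin d) ℂ) :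
    Matrix (Fin (m + n) → Fin d) (Fin (m + n) → Fin d) ℂ :=
  Matrix.of fun x y =>
    A (fun i => x (Fin.castAdd n i)) (fun i => y (Fin.castAdd n i)) *
      B (fun j => x (Fin.natAdd m j)) (fun j => y (Fin.natAdd m j))

/-- Permutation action on operators on `H^{⊗k}`. -/
def permOp {d k : ℕ} (π : Equiv.Perm (Fin k))
    (A : Matrix (Fin k → Fin d) (Fin k → Fin d) ℂ) :
    Matrix (Fin k → Fin d) (Fin k → Fin d) ℂ :=
  Matrix.of fun x y => A (x ∘ π) (y ∘ π)

/-! ### Hypothesis testing -/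

/-- A test: an operator `T` with `0 ≤ T ≤ I`. -/
def IsTest (T : Matrix ι ι ℂ) : Prop := T.PosSemidef ∧ (1 - T).PosSemidef

/-- Type I error `α_n(ρ|T) = Tr[(I - T) ρ^{⊗n}]`. -/
def typeI {d : ℕ} (ρ : Matrix (Fin d) (Fin d) ℂ) (n : ℕ)
    (T : Matrix (Fin n → Fin d) (Fin n → Fin d) ℂ) : ℝ :=
  rtr ((1 - T) * tpow ρ n)

/-- Type II error `β_n(S|T) = sup_{σ ∈ S} Tr[σ T]`. -/
def typeII {d n : ℕ} (S : Set (Matrix (Fin n → Fin d) (Fin n → Fin d) ℂ))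
    (T : Matrix (Fin n → Fin d) (Fin n → Fin d) ℂ) : ℝ :=
  sSup ((fun σ => rtr (σ * T)) '' S)

/-- `- log x`, valued in `EReal`, with `- log x = +∞` for `x ≤ 0`. -/
def negLog (x : ℝ) : EReal := if x ≤ 0 then ⊤ else ((- Real.log x : ℝ) : EReal)

/-- The exponential rate `-(1/n) log x`. -/
def rate (n : ℕ) (x : ℝ) : EReal := (((n : ℝ)⁻¹ : ℝ) : EReal) * negLog x

/-- The Stein exponent `s(ρ‖{S_n})`. -/
def steinExp {d : ℕ} (ρ : Matrix (Fin d) (Fin d) ℂ)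
    (S : (n : ℕ) → Set (Matrix (Fin n → Fin d) (Fin n → Fin d) ℂ)) : EReal :=
  sSup ((fun r : ℝ => (r : EReal)) ''
    {r : ℝ | 0 ≤ r ∧ ∃ T : (n : ℕ) → Matrix (Fin n → Fin d) (Fin n → Fin d) ℂ,
      (∀ n, IsTest (T n)) ∧
      (r : EReal) ≤ Filter.liminf (fun n => rate n (typeII (S n) (T n))) Filter.atTop ∧
      Filter.Tendsto (fun n => typeI ρ n (T n)) Filter.atTop (nhds 0)})

/-- The Chernoff exponent `c(ρ‖{S_n})`. -/
def chernoffExp {d : ℕ} (ρ : Matrix (Fin d) (Fin d) ℂ)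
    (S : (n : ℕ) → Set (Matrix (Fin n → Fin d) (Fin n → Fin d) ℂ)) : EReal :=
  Filter.liminf (fun n =>
    rate n (sInf ((fun T => typeI ρ n T + typeII (S n) T) '' {T | IsTest T}))) Filter.atTop

/-- The Hoeffding (direct) exponent `d_r(ρ‖{S_n})`. -/
def hoeffdingExp {d : ℕ} (r : ℝ) (ρ : Matrix (Fin d) (Fin d) ℂ)
    (S : (n : ℕ) → Set (Matrix (Fin n → Fin d) (Fin n → Fin d) ℂ)) : EReal :=
  ⨆ T : {T : (n : ℕ) → Matrix (Fin n → Fin d) (Fin n → Fin d) ℂ //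
      (∀ n, IsTest (T n)) ∧
      (r : EReal) ≤ Filter.liminf (fun n => rate n (typeII (S n) (T n))) Filter.atTop},
    Filter.liminf (fun n => rate n (typeI ρ n (T.1 n))) Filter.atTop

/-- The strong converse exponent `sc_r(ρ‖{S_n})`. -/
def scExp {d : ℕ} (r : ℝ) (ρ : Matrix (Fin d) (Fin d) ℂ)
    (S : (n : ℕ) → Set (Matrix (Fin n → Fin d) (Fin n → Fin d) ℂ)) : EReal :=
  ⨅ T : {T : (n : ℕ) → Matrix (Fin n → Fin d) (Fin n → Fin d) ℂ //
      (∀ n, IsTest (T n)) ∧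
      (r : EReal) ≤ Filter.liminf (fun n => rate n (typeII (S n) (T n))) Filter.atTop},
    Filter.limsup (fun n => rate n (1 - typeI ρ n (T.1 n))) Filter.atTop

/-- Assumption 1 of the paper for a family `{S_n}_{n ≥ 1}` of sets of operators
on `H^{⊗n}`, `H = ℂ^d`: each `S_n` is a convex compact set of positive semidefinite
operators, closed under tensor products, and with polar sets closed under tensor
products. -/
structure Assumption1 {d : ℕ}
    (S : (n : ℕ) → Set (Matrix (Fin n → Fin d) (Fin n → Fin d) ℂ)) : Prop where
  psd : ∀ n, 1 ≤ n → ∀ X ∈ S n, X.PosSemidef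
  convex : ∀ n, 1 ≤ n → Convex ℝ (S n)
  compact : ∀ n, 1 ≤ n → IsCompact (S n)
  tens : ∀ m n, 1 ≤ m → 1 ≤ n → ∀ A ∈ S m, ∀ B ∈ S n, tensOp A B ∈ S (m + n)
  polarTens : ∀ m n, 1 ≤ m → 1 ≤ n →
    ∀ A ∈ polar (S m), ∀ B ∈ polar (S n), tensOp A B ∈ polar (S (m + n))

/-- Assumption 1′ of the paper for a dimension-indexed family `{S_d}_{d ≥ 1}`. -/
structure Assumption1' (S : (d : ℕ) → Set (Matrix (Fin d) (Fin d) ℂ)) : Prop where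
  psd : ∀ d, 1 ≤ d → ∀ X ∈ S d, X.PosSemidef
  convex : ∀ d, 1 ≤ d → Convex ℝ (S d)
  compact : ∀ d, 1 ≤ d → IsCompact (S d)
  tens : ∀ d₁ d₂, 1 ≤ d₁ → 1 ≤ d₂ → ∀ A ∈ S d₁, ∀ B ∈ S d₂, dtens A B ∈ S (d₁ * d₂)
  polarTens : ∀ d₁ d₂, 1 ≤ d₁ → 1 ≤ d₂ →
    ∀ A ∈ polar (S d₁), ∀ B ∈ polar (S d₂), dtens A B ∈ polar (S (d₁ * d₂))

end QHT

namespace QHT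

/-- The Stieltjes-type integral `∫₀^∞ t ^ w / ((a + t) (b + t)) dt`. -/
def stieltjes (w a b : ℂ) : ℂ := ∫ t in Ioi (0 : ℝ), (t : ℂ) ^ w / ((a + t) * (b + t))

lemma image_div_one_add : (fun t : ℝ => t / (1 + t)) '' Ioi 0 = Ioo 0 1 := by
  ext u
  simp only [Set.mem_image, mem_Ioi, mem_Ioo]
  constructor
  · rintro ⟨t, ht, rfl⟩
    exact ⟨by positivity, by rw [div_lt_one (by positivity)]; linarith⟩
  · rintro ⟨h0, h1⟩
    have : 1 - u ≠ 0 := by linarith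
    refine ⟨u / (1 - u), div_pos h0 (by linarith), ?_⟩
    field_simp
    ring

lemma injOn_div_one_add : InjOn (fun t : ℝ => t / (1 + t)) (Ioi 0) := by
  intro s hs t ht h
  have hs' : (1 + s) ≠ 0 := by have : 0 < s := hs; positivity
  have ht' : (1 + t) ≠ 0 := by have : 0 < t := ht; positivity
  simp only at h
  field_simp at h
  linarith

lemma hasDerivWithinAt_div_one_add {t : ℝ} (ht : t ∈ Ioi (0 : ℝ)) :
    HasDerivWithinAt (fun t : ℝ => t / (1 + t)) (1 / (1 + t) ^ 2) (Ioi 0) t := by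
  have h0 : 0 < t := ht
  have h := (hasDerivAt_id t).div ((hasDerivAt_id t).const_add 1)
    (by simp only [id_eq]; positivity)
  refine (h.congr_deriv ?_).hasDerivWithinAt
  simp

lemma beta_integrand_comp (w : ℂ) {t : ℝ} (ht : t ∈ Ioi (0 : ℝ)) :
    |1 / (1 + t) ^ 2| • (((t / (1 + t) : ℝ) : ℂ) ^ ((1 + w) - 1) *
      (1 - ((t / (1 + t) : ℝ) : ℂ)) ^ ((1 - w) - 1)) =
    (t : ℂ) ^ w / ((1 + t) * (1 + t)) := by
  have h0 : 0 < t := ht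
  have h1 : 0 < 1 + t := by positivity
  have e : (1 : ℂ) - ((t / (1 + t) : ℝ) : ℂ) = (((1 + t)⁻¹ : ℝ) : ℂ) := by
    rw [← Complex.ofReal_one, ← Complex.ofReal_sub]
    congr 1
    field_simp
    ring
  have e1 : (1 + w) - 1 = w := by ring
  have e2 : (1 - w) - 1 = -w := by ring
  rw [e, e1, e2, abs_of_pos (by positivity), div_eq_mul_inv t, Complex.ofReal_mul,
    Complex.mul_cpow_ofReal_nonneg h0.le (by positivity), Complex.cpow_neg, mul_assoc,
    mul_inv_cancel₀, Complex.real_smul]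
  · push_cast
    field_simp
  · rw [Complex.cpow_ne_zero_iff]
    left
    exact_mod_cast (inv_pos.2 h1).ne'

lemma integrableOn_stieltjes_one {w : ℂ} (h₁ : -1 < w.re) (h₂ : w.re < 1) :
    IntegrableOn (fun t : ℝ => (t : ℂ) ^ w / ((1 + t) * (1 + t))) (Ioi 0) := by
  have h := Complex.betaIntegral_convergent (u := 1 + w) (v := 1 - w)
    (by simp; linarith) (by simp; linarith)
  rw [intervalIntegrable_iff_integrableOn_Ioo_of_le zero_le_one, ← image_div_one_add,
    integrableOn_image_iff_integrableOn_abs_deriv_smul measurableSet_Ioi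
      (fun t ht => hasDerivWithinAt_div_one_add ht) injOn_div_one_add] at h
  exact h.congr_fun (fun t ht => beta_integrand_comp w ht) measurableSet_Ioi

lemma stieltjes_one_one {w : ℂ} (h₁ : -1 < w.re) (h₂ : w.re < 1) :
    stieltjes w 1 1 = Complex.Gamma (1 + w) * Complex.Gamma (1 - w) := by
  rw [Complex.Gamma_mul_Gamma_eq_betaIntegral (by simp; linarith) (by simp; linarith),
    Complex.betaIntegral, intervalIntegral.integral_of_le zero_le_one, integral_Ioc_eq_integral_Ioo,
    ← image_div_one_add, integral_image_eq_integral_abs_deriv_smul measurableSet_Ioi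
      (fun t ht => hasDerivWithinAt_div_one_add ht) injOn_div_one_add,
    setIntegral_congr_fun measurableSet_Ioi (fun t ht => beta_integrand_comp w ht), stieltjes]
  have : (1 + w + (1 - w)) = ((1 : ℕ) : ℂ) + 1 := by push_cast; ring
  rw [this, Complex.Gamma_nat_eq_factorial]
  simp

lemma stieltjes_one_one_of_ne_zero {w : ℂ} (h₁ : -1 < w.re) (h₂ : w.re < 1) (hw : w ≠ 0) :
    stieltjes w 1 1 = Real.pi * w / Complex.sin (Real.pi * w) := by
  rw [stieltjes_one_one h₁ h₂, add_comm, Complex.Gamma_add_one w hw, mul_assoc,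
    Complex.Gamma_mul_Gamma_one_sub]
  ring

lemma stieltjes_zero_one_one : stieltjes 0 1 1 = 1 := by
  rw [stieltjes_one_one (by simp) (by simp)]
  simp

/-- Locally uniform lower bound for `z + t` on the slit plane. -/
lemma exists_lower_bound_add {a : ℂ} (ha : a ∈ Complex.slitPlane) :
    ∃ c > 0, ∀ z ∈ Metric.ball a c, ∀ t : ℝ, 0 ≤ t → c * (1 + t) ≤ ‖z + t‖ := by
  have hcpt : IsCompact ((fun u : ℝ => (1 - u : ℂ) + u * a) '' Icc 0 1) :=
    isCompact_Icc.image (by fun_prop)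
  have hsub : (fun u : ℝ => (1 - u : ℂ) + u * a) '' Icc 0 1 ⊆ Complex.slitPlane := by
    rintro _ ⟨u, ⟨hu0, hu1⟩, rfl⟩
    have := Complex.starConvex_one_slitPlane ha (sub_nonneg.2 hu1) hu0 (by ring)
    simpa using this
  obtain ⟨m, hm, hmin⟩ := hcpt.exists_isMinOn (f := fun z : ℂ => ‖z‖)
    ⟨_, 0, by simp, rfl⟩ continuous_norm.continuousOn
  have hpos : 0 < ‖m‖ := norm_pos_iff.2 (Complex.slitPlane_ne_zero (hsub hm))
  refine ⟨‖m‖ / 2, by positivity, fun z hz t ht => ?_⟩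
  have h1 : 0 < 1 + t := by positivity
  have h1c : (1 + t : ℂ) ≠ 0 := by exact_mod_cast h1.ne'
  have key : ‖m‖ ≤ ‖(1 - ((1 / (1 + t) : ℝ) : ℂ)) + ((1 / (1 + t) : ℝ) : ℂ) * a‖ :=
    hmin ⟨1 / (1 + t), ⟨by positivity, by rw [div_le_one h1]; linarith⟩, rfl⟩
  have e : (a + t : ℂ) =
      ((1 + t : ℝ) : ℂ) * ((1 - ((1 / (1 + t) : ℝ) : ℂ)) + ((1 / (1 + t) : ℝ) : ℂ) * a) := by
    push_cast
    field_simp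
    ring
  have h2 : (1 + t) * ‖m‖ ≤ ‖a + t‖ := by
    rw [e, norm_mul, Complex.norm_real, Real.norm_of_nonneg h1.le]
    gcongr
  have h3 : ‖a + t‖ ≤ ‖z + t‖ + ‖z - a‖ := by
    have : a + t = (z + t) - (z - a) := by ring
    rw [this]
    exact norm_sub_le _ _
  have h4 : ‖z - a‖ < ‖m‖ / 2 := by simpa [dist_eq_norm] using hz
  nlinarith

lemma integrableOn_stieltjes {w a b : ℂ} (h₁ : -1 < w.re) (h₂ : w.re < 1)
    (ha : a ∈ Complex.slitPlane) (hb : b ∈ Complex.slitPlane) :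
    IntegrableOn (fun t : ℝ => (t : ℂ) ^ w / ((a + t) * (b + t))) (Ioi 0) := by
  obtain ⟨c, hc, hca⟩ := exists_lower_bound_add ha
  obtain ⟨d, hd, hdb⟩ := exists_lower_bound_add hb
  refine ((integrableOn_stieltjes_one h₁ h₂).norm.const_mul (c * d)⁻¹).mono'
    (Measurable.aestronglyMeasurable (by fun_prop)) ?_
  filter_upwards [ae_restrict_mem measurableSet_Ioi] with t ht
  have ht0 : 0 < t := ht
  have h1 : ‖(1 + t : ℂ)‖ = 1 + t := by
    rw [← Complex.ofReal_one, ← Complex.ofReal_add, Complex.norm_real,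
      Real.norm_of_nonneg (by positivity)]
  have ka := hca a (Metric.mem_ball_self hc) t ht0.le
  have kb := hdb b (Metric.mem_ball_self hd) t ht0.le
  rw [norm_div, norm_div, norm_mul, norm_mul, h1]
  calc ‖(t : ℂ) ^ w‖ / (‖a + t‖ * ‖b + t‖)
      ≤ ‖(t : ℂ) ^ w‖ / ((c * (1 + t)) * (d * (1 + t))) := by gcongr
    _ = (c * d)⁻¹ * (‖(t : ℂ) ^ w‖ / ((1 + t) * (1 + t))) := by field_simp

lemma add_ofReal_ne_zero {a : ℂ} (ha : a ∈ Complex.slitPlane) {t : ℝ} (ht : 0 ≤ t) :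
    a + t ≠ 0 := by
  obtain ⟨c, hc, h⟩ := exists_lower_bound_add ha
  have := h a (Metric.mem_ball_self hc) t ht
  exact norm_pos_iff.1 (lt_of_lt_of_le (by positivity) this)

lemma sub_mul_stieltjes {w a b : ℂ} (h₁ : -1 < w.re) (h₂ : w.re < 1)
    (ha : a ∈ Complex.slitPlane) (hb : b ∈ Complex.slitPlane) :
    (a - b) * stieltjes w a b = (a - 1) * stieltjes w a 1 - (b - 1) * stieltjes w b 1 := by
  have h1 := Complex.one_mem_slitPlane
  simp only [stieltjes, ← integral_const_mul]
  rw [← integral_sub ((integrableOn_stieltjes h₁ h₂ ha h1).const_mul _)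
    ((integrableOn_stieltjes h₁ h₂ hb h1).const_mul _)]
  refine setIntegral_congr_fun measurableSet_Ioi fun t ht => ?_
  have ht' : 0 ≤ t := le_of_lt ht
  have := add_ofReal_ne_zero ha ht'
  have := add_ofReal_ne_zero hb ht'
  have := add_ofReal_ne_zero h1 ht'
  field_simp
  ring

lemma hasDerivAt_sub_one_mul_stieltjes {w a : ℂ} (h₁ : -1 < w.re) (h₂ : w.re < 1)
    (ha : a ∈ Complex.slitPlane) :
    HasDerivAt (fun z => (z - 1) * stieltjes w z 1) (stieltjes w a a) a := by
  have h1 := Complex.one_mem_slitPlane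
  obtain ⟨c, hc, hca⟩ := exists_lower_bound_add ha
  simp only [stieltjes, ← integral_const_mul]
  refine (hasDerivAt_integral_of_dominated_loc_of_deriv_le
    (bound := fun t : ℝ => (c * c)⁻¹ * ‖(t : ℂ) ^ w / ((1 + t) * (1 + t))‖)
    (F' := fun (z : ℂ) (t : ℝ) => (t : ℂ) ^ w / ((z + t) * (z + t)))
    (Metric.ball_mem_nhds a hc) (Eventually.of_forall fun z =>
      Measurable.aestronglyMeasurable (by fun_prop))
    ((integrableOn_stieltjes h₁ h₂ ha h1).const_mul _)
    (Measurable.aestronglyMeasurable (by fun_prop)) ?_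
    ((integrableOn_stieltjes_one h₁ h₂).norm.const_mul _) ?_).2
  · filter_upwards [ae_restrict_mem measurableSet_Ioi] with t ht z hz
    have ht0 : 0 < t := ht
    have e1 : ‖(1 + t : ℂ)‖ = 1 + t := by
      rw [← Complex.ofReal_one, ← Complex.ofReal_add, Complex.norm_real,
        Real.norm_of_nonneg (by positivity)]
    have ka := hca z hz t ht0.le
    rw [norm_div, norm_div, norm_mul, norm_mul, e1]
    calc ‖(t : ℂ) ^ w‖ / (‖z + t‖ * ‖z + t‖)
        ≤ ‖(t : ℂ) ^ w‖ / ((c * (1 + t)) * (c * (1 + t))) := by gcongr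
      _ = (c * c)⁻¹ * (‖(t : ℂ) ^ w‖ / ((1 + t) * (1 + t))) := by field_simp
  · filter_upwards [ae_restrict_mem measurableSet_Ioi] with t ht z hz
    have ht0 : 0 < t := ht
    have hz0 : z + t ≠ 0 :=
      norm_pos_iff.1 (lt_of_lt_of_le (by positivity) (hca z hz t ht0.le))
    have h10 := add_ofReal_ne_zero h1 ht0.le
    have hd := ((hasDerivAt_id z).sub_const 1).mul
      ((hasDerivAt_const z ((t : ℂ) ^ w)).div
        (((hasDerivAt_id z).add_const (t : ℂ)).mul_const (1 + t : ℂ)) (mul_ne_zero hz0 h10))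
    refine hd.congr_deriv ?_
    simp only [id_eq, Pi.div_apply]
    field_simp
    ring

lemma stieltjes_ofReal_self (w : ℂ) {r : ℝ} (hr : 0 < r) :
    stieltjes w r r = (r : ℂ) ^ (w - 1) * stieltjes w 1 1 := by
  have hrc : (r : ℂ) ≠ 0 := by exact_mod_cast hr.ne'
  have h := integral_comp_mul_left_Ioi
    (fun t : ℝ => (t : ℂ) ^ w / (((r : ℂ) + t) * ((r : ℂ) + t))) 0 hr
  rw [mul_zero] at h
  rw [stieltjes, ← inv_smul_eq_iff₀ (inv_ne_zero hr.ne') |>.2 h, inv_inv, stieltjes,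
    ← integral_const_mul, ← integral_smul]
  refine setIntegral_congr_fun measurableSet_Ioi fun t ht => ?_
  have ht0 : 0 < t := ht
  have h10 := add_ofReal_ne_zero Complex.one_mem_slitPlane ht0.le
  have e : (r : ℂ) + (r * t : ℝ) = r * (1 + t) := by push_cast; ring
  rw [e, Complex.ofReal_mul, Complex.mul_cpow_ofReal_nonneg hr.le ht0.le,
    Complex.cpow_sub _ _ hrc, Complex.cpow_one, Complex.real_smul]
  field_simp

lemma isPreconnected_slitPlane : IsPreconnected Complex.slitPlane :=
  (Complex.starConvex_one_slitPlane.isPathConnected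
    Complex.one_mem_slitPlane).isConnected.isPreconnected

lemma stieltjes_self {w a : ℂ} (h₁ : -1 < w.re) (h₂ : w.re < 1) (ha : a ∈ Complex.slitPlane) :
    stieltjes w a a = a ^ (w - 1) * stieltjes w 1 1 := by
  have hd : DifferentiableOn ℂ (fun z => stieltjes w z z) Complex.slitPlane := by
    have hM : DifferentiableOn ℂ (fun z => (z - 1) * stieltjes w z 1) Complex.slitPlane :=
      fun z hz => (hasDerivAt_sub_one_mul_stieltjes h₁ h₂ hz).differentiableAt.differentiableWithinAt
    exact (hM.deriv Complex.isOpen_slitPlane).congr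
      fun z hz => (hasDerivAt_sub_one_mul_stieltjes h₁ h₂ hz).deriv.symm
  have hp : DifferentiableOn ℂ (fun z : ℂ => z ^ (w - 1) * stieltjes w 1 1) Complex.slitPlane :=
    fun z hz => (((hasDerivAt_id z).cpow_const hz).mul_const
      _).differentiableAt.differentiableWithinAt
  refine (hd.analyticOnNhd Complex.isOpen_slitPlane).eqOn_of_preconnected_of_frequently_eq
    (hp.analyticOnNhd Complex.isOpen_slitPlane) isPreconnected_slitPlane
    Complex.one_mem_slitPlane ?_ ha
  have ht : Tendsto (fun r : ℝ => (r : ℂ)) (nhdsWithin 1 {1}ᶜ) (nhdsWithin 1 {1}ᶜ) := by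
    refine tendsto_nhdsWithin_iff.2 ⟨?_, ?_⟩
    · exact (Complex.continuous_ofReal.tendsto' 1 1 (by simp)).mono_left nhdsWithin_le_nhds
    · filter_upwards [self_mem_nhdsWithin] with r hr
      simpa using hr
  refine ht.frequently (Eventually.frequently ?_)
  filter_upwards [mem_nhdsWithin_of_mem_nhds (Ioi_mem_nhds (zero_lt_one (α := ℝ)))] with r hr
  exact stieltjes_ofReal_self w hr

lemma sub_one_mul_stieltjes_one {w a : ℂ} (h₁ : -1 < w.re) (h₂ : w.re < 1) (hw : w ≠ 0)
    (ha : a ∈ Complex.slitPlane) :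
    (a - 1) * stieltjes w a 1 = stieltjes w 1 1 * ((a ^ w - 1) / w) := by
  have hder : ∀ z ∈ Complex.slitPlane, HasDerivAt
      (fun z : ℂ => stieltjes w 1 1 * ((z ^ w - 1) / w)) (stieltjes w z z) z := fun z hz => by
    refine (((((hasDerivAt_id z).cpow_const hz).sub_const 1).div_const w).const_mul
      (stieltjes w 1 1)).congr_deriv ?_
    rw [stieltjes_self h₁ h₂ hz]
    simp only [id_eq]
    field_simp
  refine Complex.isOpen_slitPlane.eqOn_of_deriv_eq isPreconnected_slitPlane
    (fun z hz => (hasDerivAt_sub_one_mul_stieltjes h₁ h₂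
      hz).differentiableAt.differentiableWithinAt)
    (fun z hz => (hder z hz).differentiableAt.differentiableWithinAt)
    (fun z hz => by rw [(hder z hz).deriv, (hasDerivAt_sub_one_mul_stieltjes h₁ h₂ hz).deriv])
    Complex.one_mem_slitPlane (by simp) ha

lemma sub_one_mul_stieltjes_zero_one {a : ℂ} (ha : a ∈ Complex.slitPlane) :
    (a - 1) * stieltjes 0 a 1 = Complex.log a := by
  have h₁ : -1 < (0 : ℂ).re := by simp
  have h₂ : (0 : ℂ).re < 1 := by simp
  have hder : ∀ z ∈ Complex.slitPlane, HasDerivAt Complex.log (stieltjes 0 z z) z := fun z hz => by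
    refine (Complex.hasDerivAt_log hz).congr_deriv ?_
    rw [stieltjes_self h₁ h₂ hz, stieltjes_zero_one_one, zero_sub, Complex.cpow_neg_one, mul_one]
  refine Complex.isOpen_slitPlane.eqOn_of_deriv_eq isPreconnected_slitPlane
    (fun z hz => (hasDerivAt_sub_one_mul_stieltjes h₁ h₂
      hz).differentiableAt.differentiableWithinAt)
    (fun z hz => (hder z hz).differentiableAt.differentiableWithinAt)
    (fun z hz => by rw [(hder z hz).deriv, (hasDerivAt_sub_one_mul_stieltjes h₁ h₂ hz).deriv])
    Complex.one_mem_slitPlane (by simp) ha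

lemma sub_mul_stieltjes_of_ne_zero {w a b : ℂ} (h₁ : -1 < w.re) (h₂ : w.re < 1) (hw : w ≠ 0)
    (ha : a ∈ Complex.slitPlane) (hb : b ∈ Complex.slitPlane) :
    (a - b) * stieltjes w a b = Real.pi * (a ^ w - b ^ w) / Complex.sin (Real.pi * w) := by
  rw [sub_mul_stieltjes h₁ h₂ ha hb, sub_one_mul_stieltjes_one h₁ h₂ hw ha,
    sub_one_mul_stieltjes_one h₁ h₂ hw hb, stieltjes_one_one_of_ne_zero h₁ h₂ hw]
  field_simp
  ring

lemma sub_mul_stieltjes_zero {a b : ℂ} (ha : a ∈ Complex.slitPlane)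
    (hb : b ∈ Complex.slitPlane) :
    (a - b) * stieltjes 0 a b = Complex.log a - Complex.log b := by
  rw [sub_mul_stieltjes (by simp) (by simp) ha hb, sub_one_mul_stieltjes_zero_one ha,
    sub_one_mul_stieltjes_zero_one hb]

lemma stieltjes_eq_integral_exp (w a b : ℂ) :
    stieltjes w a b = ∫ s : ℝ, Real.pi * Complex.exp (Real.pi * s) *
      Complex.exp (Real.pi * s * w) /
        ((a + Complex.exp (Real.pi * s)) * (b + Complex.exp (Real.pi * s))) := by
  have himg : (fun s : ℝ => Real.exp (Real.pi * s)) '' univ = Ioi 0 := by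
    ext u
    simp only [Set.mem_image, mem_univ, true_and, mem_Ioi]
    constructor
    · rintro ⟨s, rfl⟩
      positivity
    · intro hu
      refine ⟨Real.log u / Real.pi, ?_⟩
      rw [mul_div_cancel₀ _ Real.pi_ne_zero, Real.exp_log hu]
  have hinj : InjOn (fun s : ℝ => Real.exp (Real.pi * s)) univ := fun s _ t _ h =>
    mul_left_cancel₀ Real.pi_ne_zero (Real.exp_injective h)
  have hder : ∀ s ∈ (univ : Set ℝ), HasDerivWithinAt (fun s : ℝ => Real.exp (Real.pi * s))
      (Real.exp (Real.pi * s) * Real.pi) univ s := fun s _ => by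
    simpa using ((hasDerivAt_id s).const_mul Real.pi).exp
  rw [stieltjes, ← himg, integral_image_eq_integral_abs_deriv_smul MeasurableSet.univ hder hinj,
    setIntegral_univ]
  congr 1 with s
  have hc : (Real.exp (Real.pi * s) : ℂ) ≠ 0 := by exact_mod_cast (Real.exp_pos _).ne'
  rw [abs_of_pos (mul_pos (Real.exp_pos _) Real.pi_pos), Complex.cpow_def_of_ne_zero hc,
    ← Complex.ofReal_log (Real.exp_pos _).le, Real.log_exp, Complex.real_smul]
  push_cast
  ring

lemma cosh_add_cos_pos {a : ℝ} (h₁ : -Real.pi < a) (h₂ : a < Real.pi) (s : ℝ) :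
    0 < Real.cosh s + Real.cos a := by
  have hc : -1 < Real.cos a := by
    rw [← Real.cos_abs a, ← Real.cos_pi]
    exact Real.cos_lt_cos_of_nonneg_of_le_pi (abs_nonneg a) le_rfl (abs_lt.2 ⟨h₁, h₂⟩)
  linarith [Real.one_le_cosh s]

lemma exp_mul_I_mem_slitPlane {a : ℝ} (h₁ : -Real.pi < a) (h₂ : a < Real.pi) :
    Complex.exp (a * Complex.I) ∈ Complex.slitPlane := by
  rw [Complex.mem_slitPlane_iff_arg]
  refine ⟨?_, Complex.exp_ne_zero _⟩
  rw [Complex.arg_exp_mul_I, toIocMod_eq_self _ |>.2]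
  · exact h₂.ne
  · exact ⟨h₁, by linarith⟩

lemma log_exp_mul_I {a : ℝ} (h₁ : -Real.pi < a) (h₂ : a < Real.pi) :
    Complex.log (Complex.exp (a * Complex.I)) = a * Complex.I :=
  Complex.log_exp (by simpa using h₁) (by simpa using h₂.le)

lemma integral_exp_div_cosh_add_cos (w : ℂ) {a : ℝ} (h₁ : -Real.pi < a) (h₂ : a < Real.pi) :
    ∫ s : ℝ, Complex.exp (Real.pi * s * w) /
      ((Real.cosh (Real.pi * s) + Real.cos a : ℝ) : ℂ) =
    2 / Real.pi * stieltjes w (Complex.exp (a * Complex.I)) (Complex.exp ((-a : ℝ) * Complex.I)) := by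
  rw [stieltjes_eq_integral_exp, ← integral_const_mul]
  congr 1 with s
  have hden : (Complex.exp (a * Complex.I) + Complex.exp (Real.pi * s)) *
      (Complex.exp ((-a : ℝ) * Complex.I) + Complex.exp (Real.pi * s)) =
      2 * Complex.exp (Real.pi * s) * ((Real.cosh (Real.pi * s) + Real.cos a : ℝ) : ℂ) := by
    have e1 : Complex.exp (a * Complex.I) * Complex.exp (-(a * Complex.I)) = 1 := by
      rw [← Complex.exp_add, add_neg_cancel, Complex.exp_zero]
    have e2 : Complex.exp (Real.pi * s) * Complex.exp (-(Real.pi * s)) = 1 := by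
      rw [← Complex.exp_add, add_neg_cancel, Complex.exp_zero]
    push_cast
    rw [Complex.cosh, Complex.cos]
    simp only [neg_mul]
    linear_combination e1 - e2
  rw [hden]
  have hc : ((Real.cosh (Real.pi * s) + Real.cos a : ℝ) : ℂ) ≠ 0 := by
    exact_mod_cast (cosh_add_cos_pos h₁ h₂ _).ne'
  have hpi : (Real.pi : ℂ) ≠ 0 := by exact_mod_cast Real.pi_ne_zero
  have := Complex.exp_ne_zero (Real.pi * s)
  field_simp

lemma betaDist_zero (t : ℝ) :
    betaDist 0 t = Real.pi / 2 / (Real.cosh (Real.pi * t) + Real.cos 0) := by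
  rw [betaDist, if_pos rfl, Real.cos_zero, div_div]

lemma betaDist_of_ne_zero {θ : ℝ} (hθ : θ ≠ 0) (t : ℝ) :
    betaDist θ t = Real.sin (θ * Real.pi) / (2 * θ) /
      (Real.cosh (Real.pi * t) + Real.cos (θ * Real.pi)) := by
  rw [betaDist, if_neg hθ, div_div]

lemma neg_pi_lt_mul_pi {θ : ℝ} (hθ : θ ∈ Ioo (-1 : ℝ) 1) : -Real.pi < θ * Real.pi := by
  nlinarith [hθ.1, Real.pi_pos]

lemma mul_pi_lt_pi {θ : ℝ} (hθ : θ ∈ Ioo (-1 : ℝ) 1) : θ * Real.pi < Real.pi := by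
  nlinarith [hθ.2, Real.pi_pos]

lemma sin_mul_pi_div_pos {θ : ℝ} (hθ : θ ∈ Ioo (-1 : ℝ) 1) (h0 : θ ≠ 0) :
    0 < Real.sin (θ * Real.pi) / (2 * θ) := by
  rcases lt_or_gt_of_ne h0 with h | h
  · exact div_pos_of_neg_of_neg (Real.sin_neg_of_neg_of_neg_pi_lt
      (mul_neg_of_neg_of_pos h Real.pi_pos) (neg_pi_lt_mul_pi hθ)) (by linarith)
  · exact div_pos (Real.sin_pos_of_pos_of_lt_pi (mul_pos h Real.pi_pos) (mul_pi_lt_pi hθ))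
      (by linarith)

lemma sin_mul_pi_ne_zero {θ : ℝ} (hθ : θ ∈ Ioo (-1 : ℝ) 1) (h0 : θ ≠ 0) :
    Real.sin (θ * Real.pi) ≠ 0 := fun h => by
  have := sin_mul_pi_div_pos hθ h0
  simp [h] at this

lemma betaDist_nonneg {θ : ℝ} (hθ : θ ∈ Ioo (-1 : ℝ) 1) (t : ℝ) : 0 ≤ betaDist θ t := by
  by_cases h0 : θ = 0
  · subst h0
    rw [betaDist_zero]
    exact div_nonneg (by positivity)
      (cosh_add_cos_pos (neg_neg_of_pos Real.pi_pos) Real.pi_pos _).le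
  · rw [betaDist_of_ne_zero h0]
    exact div_nonneg (sin_mul_pi_div_pos hθ h0).le
      (cosh_add_cos_pos (neg_pi_lt_mul_pi hθ) (mul_pi_lt_pi hθ) _).le

lemma integral_exp_mul_betaDist_zero (w : ℂ) :
    ∫ s : ℝ, Complex.exp (Real.pi * s * w) * (betaDist 0 s : ℂ) = stieltjes w 1 1 := by
  have h := integral_exp_div_cosh_add_cos w (neg_neg_of_pos Real.pi_pos) Real.pi_pos
  have hpi : (Real.pi : ℂ) ≠ 0 := by exact_mod_cast Real.pi_ne_zero
  simp only [neg_zero, Complex.ofReal_zero, zero_mul, Complex.exp_zero] at h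
  have h' : stieltjes w 1 1 = Real.pi / 2 * (2 / Real.pi * stieltjes w 1 1) := by field_simp
  rw [h', ← h, ← integral_const_mul]
  congr 1 with s
  rw [betaDist_zero]
  push_cast
  ring

lemma integral_exp_mul_betaDist (w : ℂ) {θ : ℝ} (hθ : θ ∈ Ioo (-1 : ℝ) 1) (h0 : θ ≠ 0) :
    ∫ s : ℝ, Complex.exp (Real.pi * s * w) * (betaDist θ s : ℂ) =
      (2 * Complex.I * Real.pi * θ)⁻¹ *
      ((Complex.exp ((θ * Real.pi : ℝ) * Complex.I) -
        Complex.exp ((-(θ * Real.pi) : ℝ) * Complex.I)) *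
      stieltjes w (Complex.exp ((θ * Real.pi : ℝ) * Complex.I))
        (Complex.exp ((-(θ * Real.pi) : ℝ) * Complex.I))) := by
  have h := integral_exp_div_cosh_add_cos w (neg_pi_lt_mul_pi hθ) (mul_pi_lt_pi hθ)
  have hpi : (Real.pi : ℂ) ≠ 0 := by exact_mod_cast Real.pi_ne_zero
  have hθc : (θ : ℂ) ≠ 0 := by exact_mod_cast h0
  have hsin : Complex.exp ((θ * Real.pi : ℝ) * Complex.I) -
      Complex.exp ((-(θ * Real.pi) : ℝ) * Complex.I) =
      2 * Complex.I * (Real.sin (θ * Real.pi) : ℂ) := by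
    rw [Complex.ofReal_sin, Complex.sin, Complex.ofReal_neg]
    linear_combination (Complex.exp (((θ * Real.pi : ℝ) : ℂ) * Complex.I) -
      Complex.exp (-((θ * Real.pi : ℝ) : ℂ) * Complex.I)) * Complex.I_mul_I
  have e : ∀ s : ℝ, Complex.exp (Real.pi * s * w) * (betaDist θ s : ℂ) =
      (Real.sin (θ * Real.pi) / (2 * θ) : ℂ) * (Complex.exp (Real.pi * s * w) /
        ((Real.cosh (Real.pi * s) + Real.cos (θ * Real.pi) : ℝ) : ℂ)) := fun s => by
    rw [betaDist_of_ne_zero h0, Complex.ofReal_div, Complex.ofReal_div]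
    push_cast
    ring
  simp only [e]
  rw [integral_const_mul, h, hsin]
  field_simp

lemma integral_exp_mul_betaDist_of_ne_zero {w : ℂ} (h₁ : -1 < w.re) (h₂ : w.re < 1) (hw : w ≠ 0)
    {θ : ℝ} (hθ : θ ∈ Ioo (-1 : ℝ) 1) (h0 : θ ≠ 0) :
    ∫ s : ℝ, Complex.exp (Real.pi * s * w) * (betaDist θ s : ℂ) =
      Complex.sin (θ * Real.pi * w) / (θ * Complex.sin (Real.pi * w)) := by
  have ha := neg_pi_lt_mul_pi hθ
  have hb := mul_pi_lt_pi hθ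
  have hpi : (Real.pi : ℂ) ≠ 0 := by exact_mod_cast Real.pi_ne_zero
  have hθc : (θ : ℂ) ≠ 0 := by exact_mod_cast h0
  rw [integral_exp_mul_betaDist w hθ h0, sub_mul_stieltjes_of_ne_zero h₁ h₂ hw
    (exp_mul_I_mem_slitPlane ha hb) (exp_mul_I_mem_slitPlane (by linarith) (by linarith)),
    Complex.cpow_def_of_ne_zero (Complex.exp_ne_zero _),
    Complex.cpow_def_of_ne_zero (Complex.exp_ne_zero _), log_exp_mul_I ha hb,
    log_exp_mul_I (by linarith) (by linarith)]
  have hsin : Complex.exp ((θ * Real.pi : ℝ) * Complex.I * w) -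
      Complex.exp ((-(θ * Real.pi) : ℝ) * Complex.I * w) =
      2 * Complex.I * Complex.sin (θ * Real.pi * w) := by
    have e1 : ((θ * Real.pi : ℝ) * Complex.I * w : ℂ) = θ * Real.pi * w * Complex.I := by
      push_cast; ring
    have e2 : ((-(θ * Real.pi) : ℝ) * Complex.I * w : ℂ) = -(θ * Real.pi * w) * Complex.I := by
      push_cast; ring
    rw [e1, e2, Complex.sin]
    linear_combination (Complex.exp (θ * Real.pi * w * Complex.I) -
      Complex.exp (-(θ * Real.pi * w) * Complex.I)) * Complex.I_mul_I
  rw [hsin]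
  field_simp

lemma integral_betaDist {θ : ℝ} (hθ : θ ∈ Ioo (-1 : ℝ) 1) : ∫ t : ℝ, betaDist θ t = 1 := by
  have key : ∫ s : ℝ, Complex.exp (Real.pi * s * 0) * (betaDist θ s : ℂ) = 1 := by
    by_cases h0 : θ = 0
    · subst h0
      rw [integral_exp_mul_betaDist_zero, stieltjes_zero_one_one]
    · have ha := neg_pi_lt_mul_pi hθ
      have hb := mul_pi_lt_pi hθ
      have hpi : (Real.pi : ℂ) ≠ 0 := by exact_mod_cast Real.pi_ne_zero
      have hθc : (θ : ℂ) ≠ 0 := by exact_mod_cast h0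
      rw [integral_exp_mul_betaDist 0 hθ h0, sub_mul_stieltjes_zero
        (exp_mul_I_mem_slitPlane ha hb) (exp_mul_I_mem_slitPlane (by linarith) (by linarith)),
        log_exp_mul_I ha hb, log_exp_mul_I (by linarith) (by linarith)]
      push_cast
      field_simp
      ring
  simp only [mul_zero, Complex.exp_zero, one_mul, integral_complex_ofReal] at key
  exact_mod_cast key

lemma divided_difference_eq_integral_Ioi {θ : ℝ} (hθ : θ ∈ Ioo (-1 : ℝ) 1) {x y : ℝ} (hx : 0 < x)
    (hy : 0 < y) (hxy : x ≠ y) :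
    (if θ = 0 then (Real.log x - Real.log y) / (x - y)
      else (x ^ θ - y ^ θ) / (θ * (x - y))) =
    sinc (θ * Real.pi) * ∫ t in Ioi (0 : ℝ), t ^ θ / ((x + t) * (y + t)) := by
  have hsub : x - y ≠ 0 := sub_ne_zero.2 hxy
  have hxs : (x : ℂ) ∈ Complex.slitPlane := Complex.ofReal_mem_slitPlane.2 hx
  have hys : (y : ℂ) ∈ Complex.slitPlane := Complex.ofReal_mem_slitPlane.2 hy
  have hst : stieltjes θ x y =
      ((∫ t in Ioi (0 : ℝ), t ^ θ / ((x + t) * (y + t)) : ℝ) : ℂ) := by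
    rw [stieltjes, ← integral_complex_ofReal]
    refine setIntegral_congr_fun measurableSet_Ioi fun t ht => ?_
    have ht' : 0 ≤ t := le_of_lt ht
    push_cast
    rw [Complex.ofReal_cpow ht']
  by_cases h0 : θ = 0
  · subst h0
    have h := sub_mul_stieltjes_zero hxs hys
    rw [← Complex.ofReal_zero, hst, ← Complex.ofReal_log hx.le, ← Complex.ofReal_log hy.le] at h
    have h' : (x - y) * (∫ t in Ioi (0 : ℝ), t ^ (0 : ℝ) / ((x + t) * (y + t))) =
      Real.log x - Real.log y := by exact_mod_cast h
    rw [if_pos rfl, ← h', zero_mul, sinc, if_pos rfl]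
    field_simp
  · have hθc : (θ : ℂ) ≠ 0 := by exact_mod_cast h0
    have h := sub_mul_stieltjes_of_ne_zero (w := θ) (by simpa using hθ.1) (by simpa using hθ.2)
      hθc hxs hys
    rw [hst, ← Complex.ofReal_cpow hx.le, ← Complex.ofReal_cpow hy.le] at h
    have h' : (x - y) * (∫ t in Ioi (0 : ℝ), t ^ θ / ((x + t) * (y + t))) =
      Real.pi * (x ^ θ - y ^ θ) / Real.sin (Real.pi * θ) := by exact_mod_cast h
    have hs := sin_mul_pi_ne_zero hθ h0
    rw [mul_comm Real.pi θ] at h'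
    rw [if_neg h0, sinc, if_neg (mul_ne_zero h0 Real.pi_ne_zero)]
    rw [eq_div_iff hs] at h'
    have hpi := Real.pi_ne_zero
    field_simp
    linear_combination -h'

lemma cpow_mul_cpow_eq_exp {x y : ℝ} (hx : 0 < x) (hy : 0 < y) (θ t : ℝ) :
    (x : ℂ) ^ (-(((1 - θ : ℝ) : ℂ) + Complex.I * (t : ℂ)) / 2) *
      (y : ℂ) ^ (-(((1 - θ : ℝ) : ℂ) - Complex.I * (t : ℂ)) / 2) =
    Complex.exp ((θ - 1) * (Real.log x + Real.log y) / 2) *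
      Complex.exp (Real.pi * t *
        (-(Complex.I * (Real.log x - Real.log y) / (2 * Real.pi)))) := by
  have hpi : (Real.pi : ℂ) ≠ 0 := by exact_mod_cast Real.pi_ne_zero
  rw [Complex.cpow_def_of_ne_zero (by exact_mod_cast hx.ne'),
    Complex.cpow_def_of_ne_zero (by exact_mod_cast hy.ne'), ← Complex.exp_add, ← Complex.exp_add,
    ← Complex.ofReal_log hx.le, ← Complex.ofReal_log hy.le]
  congr 1
  push_cast
  field_simp
  ring

lemma sin_neg_I_mul_half (v : ℂ) :
    Complex.sin (-(Complex.I * v / 2)) =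
      -(Complex.I / 2) * (Complex.exp (v / 2) - Complex.exp (-(v / 2))) := by
  rw [show -(Complex.I * v / 2) = -(v / 2) * Complex.I by ring, Complex.sin_mul_I, Complex.sinh,
    neg_neg]
  ring

lemma exp_mul_exp_half_sub (p q : ℂ) (c : ℂ) :
    Complex.exp (c * (p + q) / 2) *
      (Complex.exp (c * (p - q) / 2) - Complex.exp (-(c * (p - q) / 2))) =
    Complex.exp (p * c) - Complex.exp (q * c) := by
  rw [mul_sub, ← Complex.exp_add, ← Complex.exp_add]
  congr 2 <;> ring

lemma divided_difference_eq_integral_betaDist {θ : ℝ} (hθ : θ ∈ Ioo (-1 : ℝ) 1) {x y : ℝ}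
    (hx : 0 < x) (hy : 0 < y) (hxy : x ≠ y) :
    ((if θ = 0 then (Real.log x - Real.log y) / (x - y)
        else (x ^ θ - y ^ θ) / (θ * (x - y)) : ℝ) : ℂ) =
      ∫ t : ℝ, (x : ℂ) ^ (-(((1 - θ : ℝ) : ℂ) + Complex.I * (t : ℂ)) / 2) *
        (y : ℂ) ^ (-(((1 - θ : ℝ) : ℂ) - Complex.I * (t : ℂ)) / 2) * (betaDist θ t : ℂ) := by
  have hpi : (Real.pi : ℂ) ≠ 0 := by exact_mod_cast Real.pi_ne_zero
  have hlog : (Real.log x - Real.log y : ℂ) ≠ 0 := by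
    rw [sub_ne_zero]
    exact_mod_cast fun h => hxy (Real.log_injOn_pos hx hy h)
  have hxc : (x : ℂ) ≠ 0 := by exact_mod_cast hx.ne'
  have hyc : (y : ℂ) ≠ 0 := by exact_mod_cast hy.ne'
  have hsub : (x - y : ℂ) ≠ 0 := sub_ne_zero.2 (by exact_mod_cast hxy)
  simp only [cpow_mul_cpow_eq_exp hx hy, mul_assoc (Complex.exp ((θ - 1) * _ / 2))]
  rw [integral_const_mul]
  set v : ℂ := Real.log x - Real.log y with hv
  set w : ℂ := -(Complex.I * v / (2 * Real.pi)) with hw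
  have hw0 : w ≠ 0 := neg_ne_zero.2 (div_ne_zero (mul_ne_zero Complex.I_ne_zero hlog) (by simp))
  have hre : w.re = 0 := by
    have : w = ((-((Real.log x - Real.log y) / (2 * Real.pi)) : ℝ) : ℂ) * Complex.I := by
      rw [hw, hv]; push_cast; ring
    rw [this, Complex.re_ofReal_mul, Complex.I_re, mul_zero]
  have h₁ : -1 < w.re := by rw [hre]; norm_num
  have h₂ : w.re < 1 := by rw [hre]; norm_num
  have hpw : Real.pi * w = -(Complex.I * v / 2) := by rw [hw]; field_simp
  have hD : Complex.exp ((Real.log x + Real.log y) / 2) *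
      (Complex.exp (v / 2) - Complex.exp (-(v / 2))) = x - y := by
    have := exp_mul_exp_half_sub (Real.log x) (Real.log y) 1
    simp only [one_mul, mul_one, ← Complex.ofReal_exp, Real.exp_log hx, Real.exp_log hy] at this
    exact this
  have hne : Complex.exp (v / 2) - Complex.exp (-(v / 2)) ≠ 0 := fun h => by
    rw [h, mul_zero] at hD
    exact hsub hD.symm
  have hexp : Complex.exp ((θ - 1) * (Real.log x + Real.log y) / 2) *
      Complex.exp ((Real.log x + Real.log y) / 2) =
      Complex.exp (θ * (Real.log x + Real.log y) / 2) := by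
    rw [← Complex.exp_add]
    congr 1
    ring
  by_cases h0 : θ = 0
  · subst h0
    rw [if_pos rfl, integral_exp_mul_betaDist_zero, stieltjes_one_one_of_ne_zero h₁ h₂ hw0, hpw,
      sin_neg_I_mul_half]
    have hexp1 : Complex.exp ((((0 : ℝ) : ℂ) - 1) * (Real.log x + Real.log y) / 2) *
      Complex.exp ((Real.log x + Real.log y) / 2) = 1 := by rw [hexp]; simp
    push_cast
    rw [← hv, ← hD]
    have hE := Complex.exp_ne_zero (((Real.log x : ℂ) + Real.log y) / 2)
    have hI := Complex.I_ne_zero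
    push_cast at hexp1
    generalize Complex.exp ((0 - 1) * (Real.log x + Real.log y) / 2) = E at hexp1 ⊢
    field_simp
    linear_combination -hexp1
  · have hθc : (θ : ℂ) ≠ 0 := by exact_mod_cast h0
    have hN := exp_mul_exp_half_sub (Real.log x) (Real.log y) θ
    rw [← hv, Complex.ofReal_log hx.le, Complex.ofReal_log hy.le,
      ← Complex.cpow_def_of_ne_zero hxc, ← Complex.cpow_def_of_ne_zero hyc,
      ← Complex.ofReal_log hx.le, ← Complex.ofReal_log hy.le] at hN
    have hθpw : θ * Real.pi * w = -(Complex.I * (θ * v) / 2) := by rw [mul_assoc, hpw]; ring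
    rw [if_neg h0, integral_exp_mul_betaDist_of_ne_zero h₁ h₂ hw0 hθ h0, hpw, hθpw,
      sin_neg_I_mul_half, sin_neg_I_mul_half]
    push_cast
    rw [Complex.ofReal_cpow hx.le, Complex.ofReal_cpow hy.le, ← hN, ← hexp, ← hD]
    have hE := Complex.exp_ne_zero (((Real.log x : ℂ) + Real.log y) / 2)
    have hI := Complex.I_ne_zero
    field_simp

/-- Lemma 4 of the paper: integral representations of the divided
difference `(x^θ - y^θ)/(θ(x-y))`, together with the fact that `β_θ` is a probability
density on `ℝ`. -/
theorem divided_difference_integral_rep (θ : ℝ) (hθ : θ ∈ Set.Ioo (-1 : ℝ) 1)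
    (x y : ℝ) (hx : 0 < x) (hy : 0 < y) (hxy : x ≠ y) :
    ((if θ = 0 then (Real.log x - Real.log y) / (x - y)
        else (x ^ θ - y ^ θ) / (θ * (x - y))) =
      sinc (θ * Real.pi) * ∫ t in Set.Ioi (0 : ℝ), t ^ θ / ((x + t) * (y + t))) ∧
    (((if θ = 0 then (Real.log x - Real.log y) / (x - y)
        else (x ^ θ - y ^ θ) / (θ * (x - y)) : ℝ) : ℂ) =
      ∫ t : ℝ, (x : ℂ) ^ (-(((1 - θ : ℝ) : ℂ) + Complex.I * (t : ℂ)) / 2) *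
        (y : ℂ) ^ (-(((1 - θ : ℝ) : ℂ) - Complex.I * (t : ℂ)) / 2) * (betaDist θ t : ℂ)) ∧
    (∀ t : ℝ, 0 ≤ betaDist θ t) ∧
    (∫ t : ℝ, betaDist θ t) = 1 :=
  ⟨divided_difference_eq_integral_Ioi hθ hx hy hxy,
    divided_difference_eq_integral_betaDist hθ hx hy hxy, betaDist_nonneg hθ,
    integral_betaDist hθ⟩

end QHT
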